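/- arXiv:math/0602183 — 5 statements merged into one kernel-verified Lean document; each statement's English description precedes it below -/
import Mathlib

section
/- Let X, Y, Z be (real) Banach spaces, U ⊆ X open, V ⊆ Y, f : U → Y with f(U) ⊆ V, g : V → Z, and let x ∈ U with f(x) ∈ V. Let n ∈ ℕ. Suppose that for every k with 0 ≤ k ≤ n, f has a k-th strict Fréchet derivative f^(k)(x) at x and g has a k-th strict Fréchet derivative g^(k)(f(x)) at f(x) (in the finite-difference sense defined in the context). Then g ∘ f has an n-th strict Fréchet derivative at x in the same sense, and for any index set I with |I| = n and vectors (v_i)_{i∈I} in X it is given by the Faà di Bruno formula: ⟨(g∘f)^(n)(x), ⊗_{i∈I} v_i⟩ = Σ_{π ∈ H(I)} ⟨g^(|π|)(f(x)), ⊗_{S∈π} ⟨f^(|S|)(x), ⊗_{i∈S} v_i⟩⟩, where H(I) denotes the set of all partitions of I into nonempty subsets. -/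
open Asymptotics

/-- `L` is the `n`-th strict Fréchet derivative of `f` at `x` in the finite-difference sense:
`L` is a continuous symmetric `n`-multilinear map and, for an index set `I` with `|I| = n`
(here `I = Fin n`),
`Σ_{S⊆I} (−1)^{|I|−|S|} f(v̄ + Σ_{i∈S} v_i) = ⟨L, ⊗_{i∈I} v_i⟩ + o(∏_{i∈I} ‖v_i‖)`
as `v̄ → x` and all `v_i → 0` jointly.  (For `n = 0` this is continuity of `f` at `x`
together with `L = f x`.) -/
def HasStrictFDerivAtOrder {X Y : Type*} [NormedAddCommGroup X] [NormedSpace ℝ X]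
    [NormedAddCommGroup Y] [NormedSpace ℝ Y] (n : ℕ) (f : X → Y) (x : X)
    (L : ContinuousMultilinearMap ℝ (fun _ : Fin n => X) Y) : Prop :=
  (∀ (v : Fin n → X) (σ : Equiv.Perm (Fin n)), L (v ∘ σ) = L v) ∧
  (fun p : X × (Fin n → X) =>
      (∑ S : Finset (Fin n), ((-1 : ℝ) ^ (n - S.card)) • f (p.1 + ∑ i ∈ S, p.2 i)) - L p.2)
    =o[nhds (x, 0)] (fun p : X × (Fin n → X) => ∏ i : Fin n, ‖p.2 i‖)

/-- `π` is a partition of the finite index set `ι` into nonempty subsets, i.e. an element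
of `H(ι)`: no block is empty and every index belongs to exactly one block. -/
def IsHPartition {ι : Type*} [DecidableEq ι] (π : Finset (Finset ι)) : Prop :=
  ∅ ∉ π ∧ ∀ i : ι, ∃! S, S ∈ π ∧ i ∈ S

section FiniteDifference

open Finset

variable {ι κ X Y Z : Type*} [AddCommGroup X] [AddCommGroup Y] [Module ℝ Y]
  [AddCommGroup Z] [Module ℝ Z]

/-- The iterated finite difference of `f` at `a` in the directions `v i`, `i ∈ S`. -/
def finDiff (f : X → Y) (S : Finset ι) (a : X) (v : ι → X) : Y :=
  ∑ T ∈ S.powerset, (-1 : ℝ) ^ (S.card - T.card) • f (a + ∑ i ∈ T, v i)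

@[simp]
theorem finDiff_empty (f : X → Y) (a : X) (v : ι → X) : finDiff f ∅ a v = f a := by
  simp [finDiff]

theorem finDiff_insert [DecidableEq ι] (f : X → Y) {i : ι} {S : Finset ι} (hi : i ∉ S) (a : X)
    (v : ι → X) :
    finDiff f (insert i S) a v = finDiff f S (a + v i) v - finDiff f S a v := by
  unfold finDiff
  rw [sum_powerset_insert hi, add_comm, sub_eq_add_neg, ← sum_neg_distrib]
  congr 1
  · refine sum_congr rfl fun T hT => ?_
    have hiT : i ∉ T := fun h => hi (mem_powerset.1 hT h)
    rw [card_insert_of_notMem hi, card_insert_of_notMem hiT, sum_insert hiT, ← add_assoc,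
      Nat.add_sub_add_right]
  · refine sum_congr rfl fun T hT => ?_
    rw [card_insert_of_notMem hi, Nat.sub_add_comm (card_le_card (mem_powerset.1 hT)), pow_succ]
    simp

theorem finDiff_map (f : X → Y) (e : κ ↪ ι) (S : Finset κ) (a : X) (v : ι → X) :
    finDiff f (S.map e) a v = finDiff f S a (v ∘ e) := by
  classical
  induction S using Finset.induction generalizing a with
  | empty => simp
  | insert i S hi ih =>
    rw [map_insert, finDiff_insert f (by simpa using hi), finDiff_insert f hi, ih, ih,
      Function.comp_apply]

/-- The discrete Taylor formula. -/
theorem sum_powerset_finDiff (f : X → Y) (S : Finset ι) (a : X) (v : ι → X) :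
    ∑ T ∈ S.powerset, finDiff f T a v = f (a + ∑ i ∈ S, v i) := by
  classical
  induction S using Finset.induction generalizing a with
  | empty => simp
  | insert i S hi ih =>
    rw [sum_powerset_insert hi, sum_insert hi, ← add_assoc, ← ih, ← sum_add_distrib]
    refine sum_congr rfl fun T hT => ?_
    rw [finDiff_insert f fun h => hi (mem_powerset.1 hT h)]
    abel

theorem finDiff_union [DecidableEq ι] (f : X → Y) {S T : Finset ι} (h : Disjoint S T) (a : X)
    (v : ι → X) :
    finDiff f (S ∪ T) a v = finDiff (fun b => finDiff f S b v) T a v := by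
  induction T using Finset.induction generalizing a with
  | empty => simp
  | insert i T hi ih =>
    rw [disjoint_insert_right] at h
    rw [union_insert, finDiff_insert f (by simp [hi, h.1]), finDiff_insert _ hi, ih h.2, ih h.2]

theorem finDiff_const (c : Y) {S : Finset ι} (hS : S.Nonempty) (a : X) (v : ι → X) :
    finDiff (fun _ => c) S a v = 0 := by
  classical
  obtain ⟨i, hi⟩ := hS
  rw [← insert_erase hi, finDiff_insert _ (notMem_erase i S)]
  simp [finDiff]

theorem finDiff_sub (f g : X → Y) (S : Finset ι) (a : X) (v : ι → X) :
    finDiff (fun b => f b - g b) S a v = finDiff f S a v - finDiff g S a v := by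
  simp [finDiff, smul_sub]

omit [Module ℝ Y] in
theorem eq_of_sum_powerset_eq {F G : Finset ι → Y}
    (h : ∀ S : Finset ι, ∑ T ∈ S.powerset, F T = ∑ T ∈ S.powerset, G T) (S : Finset ι) : F S = G S := by
  classical
  induction S using Finset.strongInduction with
  | H S ih =>
    have hS := h S
    rw [← insert_erase (mem_powerset_self S), sum_insert (notMem_erase _ _),
      sum_insert (notMem_erase _ _)] at hS
    rwa [sum_congr rfl fun T hT => ih T ?_, add_left_inj] at hS
    rw [mem_erase, mem_powerset] at hT
    exact hT.2.ssubset_of_ne hT.1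

/-- The finite difference of a composition is a sum over all coverings of the index set. -/
theorem finDiff_comp [Fintype ι] [DecidableEq ι] (g : Y → Z) (f : X → Y) (S : Finset ι) (a : X)
    (v : ι → X) :
    finDiff (g ∘ f) S a v =
      ∑ B : Finset (Finset ι) with ∅ ∉ B ∧ B.sup id = S,
        finDiff g B (f a) fun T => finDiff f T a v := by
  refine eq_of_sum_powerset_eq (F := fun S => finDiff (g ∘ f) S a v)
    (G := fun S => ∑ B : Finset (Finset ι) with ∅ ∉ B ∧ B.sup id = S,
      finDiff g B (f a) fun T => finDiff f T a v) (fun S => ?_) S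
  have hf : f (a + ∑ i ∈ S, v i) =
      f a + ∑ T ∈ S.powerset.erase ∅, finDiff f T a v := by
    rw [← sum_powerset_finDiff f S a v, ← add_sum_erase _ _ (empty_mem_powerset S), finDiff_empty]
  rw [sum_powerset_finDiff, Function.comp_apply, hf, ← sum_powerset_finDiff g]
  rw [sum_comm' (t' := (S.powerset.erase ∅).powerset) (s' := fun B => {B.sup id})]
  · simp
  · intro T B
    simp only [mem_powerset, mem_filter, mem_univ, true_and, mem_singleton, subset_erase]
    constructor
    · rintro ⟨hT, hB, rfl⟩
      exact ⟨rfl, fun A hA => mem_powerset.2 ((le_sup (f := id) hA).trans hT), hB⟩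
    · rintro ⟨rfl, hB, hB'⟩
      exact ⟨Finset.sup_le fun A hA => mem_powerset.1 (hB hA), hB', rfl⟩

end FiniteDifference

section Asymptotic

open Filter Topology Finset

variable {ι α X Y Z : Type*} [NormedAddCommGroup X] [NormedSpace ℝ X]
  [NormedAddCommGroup Y] [NormedSpace ℝ Y] [NormedAddCommGroup Z] [NormedSpace ℝ Z]
  {l : Filter α}

theorem hasStrictFDerivAtOrder_isLittleO_iff {n : ℕ} {f : X → Y} {x : X}
    {L : ContinuousMultilinearMap ℝ (fun _ : Fin n => X) Y} :
    HasStrictFDerivAtOrder n f x L ↔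
      (∀ (v : Fin n → X) (σ : Equiv.Perm (Fin n)), L (v ∘ σ) = L v) ∧
      (fun p : X × (Fin n → X) => finDiff f univ p.1 p.2 - L p.2)
        =o[𝓝 (x, 0)] fun p => ∏ i, ‖p.2 i‖ := by
  simp [HasStrictFDerivAtOrder, finDiff]

theorem HasStrictFDerivAtOrder.continuousAt {f : X → Y} {x : X}
    {L : ContinuousMultilinearMap ℝ (fun _ : Fin 0 => X) Y}
    (h : HasStrictFDerivAtOrder 0 f x L) : ContinuousAt f x := by
  have ht : Tendsto (fun a : X => (a, (0 : Fin 0 → X))) (𝓝 x) (𝓝 (x, 0)) :=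
    tendsto_id.prodMk_nhds tendsto_const_nhds
  have h0 := (hasStrictFDerivAtOrder_isLittleO_iff.1 h).2.comp_tendsto ht
  simp only [univ_eq_empty, finDiff_empty, prod_empty, Function.comp_def] at h0
  exact continuousAt_of_tendsto_nhds (tendsto_sub_nhds_zero_iff.1 ((isLittleO_one_iff ℝ).1 h0))

theorem HasStrictFDerivAtOrder.finDiff_sub_isLittleO {S : Finset ι} {f : X → Y} {x : X}
    {L : ContinuousMultilinearMap ℝ (fun _ : Fin S.card => X) Y}
    (h : HasStrictFDerivAtOrder S.card f x L) {a : α → X} {v : α → ι → X}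
    (ha : Tendsto a l (𝓝 x)) (hv : ∀ i ∈ S, Tendsto (v · i) l (𝓝 0)) :
    (fun t => finDiff f S (a t) (v t) - L fun i => v t (S.equivFin.symm i))
      =o[l] fun t => ∏ i ∈ S, ‖v t i‖ := by
  let e : Fin S.card ↪ ι := S.equivFin.symm.toEmbedding.trans (Function.Embedding.subtype _)
  have he : univ.map e = S := by
    rw [← Finset.map_map, map_univ_equiv, univ_eq_attach, attach_map_val]
  have ht : Tendsto (fun t => (a t, v t ∘ e)) l (𝓝 (x, 0)) := by
    refine ha.prodMk_nhds (tendsto_pi_nhds.2 fun i => hv _ ?_)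
    exact (S.equivFin.symm i).2
  refine ((hasStrictFDerivAtOrder_isLittleO_iff.1 h).2.comp_tendsto ht).congr
    (fun t => ?_) (fun t => ?_)
  · simp only [Function.comp_apply]
    rw [← finDiff_map, he]
    rfl
  · simp only [Function.comp_apply]
    conv_rhs => rw [← he, prod_map]

theorem HasStrictFDerivAtOrder.finDiff_isBigO {S : Finset ι} {f : X → Y} {x : X}
    {L : ContinuousMultilinearMap ℝ (fun _ : Fin S.card => X) Y}
    (h : HasStrictFDerivAtOrder S.card f x L) {a : α → X} {v : α → ι → X}
    (ha : Tendsto a l (𝓝 x)) (hv : ∀ i ∈ S, Tendsto (v · i) l (𝓝 0)) :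
    (fun t => finDiff f S (a t) (v t)) =O[l] fun t => ∏ i ∈ S, ‖v t i‖ := by
  have hL : (fun t => L fun i => v t (S.equivFin.symm i)) =O[l] fun t => ∏ i ∈ S, ‖v t i‖ := by
    refine IsBigO.of_bound ‖L‖ (Eventually.of_forall fun t => (L.le_opNorm _).trans_eq ?_)
    rw [Real.norm_of_nonneg (by positivity), S.equivFin.symm.prod_comp fun i : S => ‖v t i‖,
      prod_coe_sort S fun i => ‖v t i‖]
  simpa using (h.finDiff_sub_isLittleO ha hv).isBigO.add hL

omit [NormedSpace ℝ X] in
theorem tendsto_zero_of_isBigO_prod {E : Type*} [NormedAddCommGroup E] {S : Finset ι}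
    (hS : S.Nonempty) {w : α → E} {v : α → ι → X} (hw : w =O[l] fun t => ∏ i ∈ S, ‖v t i‖)
    (hv : ∀ i ∈ S, Tendsto (v · i) l (𝓝 0)) : Tendsto w l (𝓝 0) := by
  refine hw.trans_tendsto ?_
  obtain ⟨i, hi⟩ := hS
  rw [← prod_eq_zero (f := fun _ : ι => (0 : ℝ)) hi rfl]
  exact tendsto_finsetProd S fun i hi => by simpa using (hv i hi).norm

/-- A multilinear map respects negligible perturbations of its arguments. -/
theorem ContinuousMultilinearMap.isLittleO_sub [Fintype ι]
    (M : ContinuousMultilinearMap ℝ (fun _ : ι => Y) Z) {u w : α → ι → Y} {φ : α → ι → ℝ}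
    (huw : ∀ i, (fun t => u t i - w t i) =o[l] (φ · i)) (hu : ∀ i, (u · i) =O[l] (φ · i)) :
    (fun t => M (u t) - M (w t)) =o[l] fun t => ∏ i, φ t i := by
  classical
  have hw (i : ι) : (w · i) =O[l] (φ · i) := by
    simpa using (hu i).sub (huw i).isBigO
  have hle : (fun t => M (u t) - M (w t)) =O[l] fun t =>
      ∑ i, ∏ j, if j = i then ‖u t i - w t i‖ else max ‖u t j‖ ‖w t j‖ := by
    refine IsBigO.of_bound ‖M‖ (Eventually.of_forall fun t => ?_)
    refine (M.norm_image_sub_le' _ _).trans ?_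
    gcongr
    exact le_abs_self _
  refine hle.trans_isLittleO (IsLittleO.fun_sum fun i _ => IsLittleO.finsetProd (fun j _ => ?_)
    ⟨i, mem_univ i, ?_⟩)
  · split_ifs with hij
    · subst hij
      exact (huw j).isBigO.norm_left
    · refine IsBigO.trans (IsBigO.of_norm_le fun t => ?_) ((hu j).norm_left.add (hw j).norm_left)
      rw [Real.norm_of_nonneg (by positivity)]
      exact max_le_add_of_nonneg (norm_nonneg _) (norm_nonneg _)
  · simpa using (huw i).norm_left

omit [NormedSpace ℝ X] in
theorem norm_pow_isBigO {w : α → X} (hw : Tendsto w l (𝓝 0)) {m : ℕ} (hm : 0 < m) :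
    (fun t => ‖w t‖ ^ m) =O[l] fun t => ‖w t‖ := by
  obtain rfl | hm := Nat.eq_or_lt_of_le (Nat.succ_le_of_lt hm)
  · simpa using isBigO_refl _ _
  · exact ((isLittleO_pow_id hm).comp_tendsto (by simpa using hw.norm)).isBigO

theorem prod_prod_eq_prod_pow [Fintype ι] [DecidableEq ι] (B : Finset (Finset ι)) (c : ι → ℝ) :
    ∏ T ∈ B, ∏ i ∈ T, c i = ∏ i, c i ^ #{T ∈ B | i ∈ T} := by
  rw [prod_comm' (t' := univ) (s' := fun i => {T ∈ B | i ∈ T}) (by simp)]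
  simp

omit [NormedSpace ℝ X] in
theorem prod_prod_isBigO_of_cover [Fintype ι] {B : Finset (Finset ι)}
    (hB : ∀ i, ∃ T ∈ B, i ∈ T) {v : α → ι → X} (hv : ∀ i, Tendsto (v · i) l (𝓝 0)) :
    (fun t => ∏ T ∈ B, ∏ i ∈ T, ‖v t i‖) =O[l] fun t => ∏ i, ‖v t i‖ := by
  classical
  simp_rw [prod_prod_eq_prod_pow]
  refine IsBigO.finsetProd fun i _ => norm_pow_isBigO (hv i) (card_pos.2 ?_)
  obtain ⟨T, hT⟩ := hB i
  exact ⟨T, mem_filter.2 hT⟩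

omit [NormedSpace ℝ X] in
theorem prod_prod_isLittleO_of_cover [Fintype ι] [DecidableEq ι] {B : Finset (Finset ι)}
    (hB : ∀ i, ∃ T ∈ B, i ∈ T) (h0 : ∅ ∉ B) (hB' : ¬ IsHPartition B) {v : α → ι → X}
    (hv : ∀ i, Tendsto (v · i) l (𝓝 0)) :
    (fun t => ∏ T ∈ B, ∏ i ∈ T, ‖v t i‖) =o[l] fun t => ∏ i, ‖v t i‖ := by
  simp_rw [prod_prod_eq_prod_pow]
  have hpos (i : ι) : 0 < #{T ∈ B | i ∈ T} := by
    obtain ⟨T, hT⟩ := hB i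
    exact card_pos.2 ⟨T, mem_filter.2 hT⟩
  refine IsLittleO.finsetProd (fun i _ => norm_pow_isBigO (hv i) (hpos i)) ?_
  simp only [IsHPartition, h0, not_false_eq_true, true_and, not_forall] at hB'
  obtain ⟨i, hi⟩ := hB'
  refine ⟨i, mem_univ i, (isLittleO_pow_id (lt_of_le_of_ne (hpos i) fun h => hi ?_)).comp_tendsto
    (by simpa using (hv i).norm)⟩
  obtain ⟨T, hT⟩ := card_eq_one.1 h.symm
  have hT' (A : Finset ι) : A ∈ B ∧ i ∈ A ↔ A = T := by
    simpa using Finset.ext_iff.1 hT A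
  exact ⟨T, (hT' T).2 rfl, fun A hA => (hT' A).1 hA⟩

/-- Only boundedly many sets are needed to cover a finite type. -/
theorem exists_subcover_card_le [Fintype ι] {B : Finset (Finset ι)}
    (hB : ∀ i, ∃ T ∈ B, i ∈ T) :
    ∃ A ⊆ B, #A ≤ Fintype.card ι ∧ ∀ i, ∃ T ∈ A, i ∈ T := by
  classical
  choose F hFB hF using hB
  exact ⟨univ.image F, image_subset_iff.2 fun i _ => hFB i, card_image_le,
    fun i => ⟨F i, mem_image_of_mem F (mem_univ i), hF i⟩⟩

theorem IsHPartition.card_le [Fintype ι] [DecidableEq ι] {B : Finset (Finset ι)}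
    (hB : IsHPartition B) : #B ≤ Fintype.card ι := by
  obtain ⟨A, hAB, hAc, hA⟩ := exists_subcover_card_le fun i => (hB.2 i).exists
  refine (card_le_card fun T hT => ?_).trans hAc
  obtain ⟨i, hi⟩ := nonempty_iff_ne_empty.2 fun h => hB.1 (h ▸ hT)
  obtain ⟨T', hT', hi'⟩ := hA i
  rwa [(hB.2 i).unique ⟨hT, hi⟩ ⟨hAB hT', hi'⟩]

section Cover

variable [Fintype ι] {f : X → Y} {x : X} {g : Y → Z} {y : Y}
  {Df : ∀ k : ℕ, ContinuousMultilinearMap ℝ (fun _ : Fin k => X) Y}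
  {Dg : ∀ k : ℕ, ContinuousMultilinearMap ℝ (fun _ : Fin k => Y) Z}
  {b : α → Y} {v : α → ι → X} {w : α → Finset ι → Y} {B : Finset (Finset ι)}

omit [NormedSpace ℝ X] in
theorem HasStrictFDerivAtOrder.finDiff_sub_isLittleO_of_cover
    (hg : HasStrictFDerivAtOrder #B g y (Dg #B))
    (hb : Tendsto b l (𝓝 y)) (hv : ∀ i, Tendsto (v · i) l (𝓝 0))
    (hw : ∀ T, (w · T) =O[l] fun t => ∏ i ∈ T, ‖v t i‖)
    (h0 : ∅ ∉ B) (hB : ∀ i, ∃ T ∈ B, i ∈ T) :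
    (fun t => finDiff g B (b t) (w t) - Dg #B fun j => w t (B.equivFin.symm j))
      =o[l] fun t => ∏ i, ‖v t i‖ := by
  refine (hg.finDiff_sub_isLittleO hb fun T hT => ?_).trans_isBigO
    ((IsBigO.finsetProd fun T _ => (hw T).norm_left).trans (prod_prod_isBigO_of_cover hB hv))
  exact tendsto_zero_of_isBigO_prod (nonempty_iff_ne_empty.2 fun h => h0 (h ▸ hT)) (hw T)
    fun i _ => hv i

omit [NormedSpace ℝ X] in
/-- Coverings that are not partitions do not contribute to the derivative of a composition. -/
theorem finDiff_isLittleO_of_not_partition [DecidableEq ι]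
    (hg : ∀ k ≤ Fintype.card ι, HasStrictFDerivAtOrder k g y (Dg k))
    (hb : Tendsto b l (𝓝 y)) (hv : ∀ i, Tendsto (v · i) l (𝓝 0))
    (hw : ∀ T, (w · T) =O[l] fun t => ∏ i ∈ T, ‖v t i‖)
    (h0 : ∅ ∉ B) (hB : ∀ i, ∃ T ∈ B, i ∈ T) (hB' : ¬ IsHPartition B) :
    (fun t => finDiff g B (b t) (w t)) =o[l] fun t => ∏ i, ‖v t i‖ := by
  have hw0 : ∀ T ∈ B, Tendsto (w · T) l (𝓝 0) := fun T hT =>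
    tendsto_zero_of_isBigO_prod (nonempty_iff_ne_empty.2 fun h => h0 (h ▸ hT)) (hw T)
      fun i _ => hv i
  by_cases hc : #B ≤ Fintype.card ι
  · exact ((hg _ hc).finDiff_isBigO hb hw0).trans_isLittleO
      ((IsBigO.finsetProd fun T _ => (hw T).norm_left).trans_isLittleO
        (prod_prod_isLittleO_of_cover hB h0 hB' hv))
  obtain ⟨A, hAB, hAc, hA⟩ := exists_subcover_card_le hB
  have hne : (B \ A).Nonempty := sdiff_nonempty.2 fun h => hc ((card_le_card h).trans hAc)
  have key (t : α) : finDiff g B (b t) (w t) =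
      finDiff (fun c => finDiff g A c (w t) - Dg #A fun j => w t (A.equivFin.symm j))
        (B \ A) (b t) (w t) := by
    rw [finDiff_sub, finDiff_const _ hne, sub_zero, ← finDiff_union _ disjoint_sdiff,
      union_sdiff_of_subset hAB]
  simp_rw [key]
  refine IsLittleO.fun_sum fun C hC => IsLittleO.const_smul_left ?_ _
  refine (hg _ hAc).finDiff_sub_isLittleO_of_cover ?_ hv hw (fun h => h0 (hAB h)) hA
  simpa using hb.add (tendsto_finsetSum C fun T hT =>
    hw0 T (sdiff_subset (mem_powerset.1 hC hT)))

/-- The terms of the Faà di Bruno formula. -/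
theorem finDiff_sub_isLittleO_of_cover
    (hg : HasStrictFDerivAtOrder #B g y (Dg #B))
    (hb : Tendsto b l (𝓝 y)) (hv : ∀ i, Tendsto (v · i) l (𝓝 0))
    (hw : ∀ T, (w · T) =O[l] fun t => ∏ i ∈ T, ‖v t i‖)
    (hw' : ∀ T, (fun t => w t T - Df #T fun i => v t (T.equivFin.symm i))
      =o[l] fun t => ∏ i ∈ T, ‖v t i‖)
    (h0 : ∅ ∉ B) (hB : ∀ i, ∃ T ∈ B, i ∈ T) :
    (fun t => finDiff g B (b t) (w t) - Dg #B fun j =>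
      Df #(B.equivFin.symm j : Finset ι) fun i =>
        v t ((B.equivFin.symm j : Finset ι).equivFin.symm i))
      =o[l] fun t => ∏ i, ‖v t i‖ := by
  have h2 := (Dg #B).isLittleO_sub (u := fun t j => w t (B.equivFin.symm j))
    (fun j => hw' (B.equivFin.symm j)) (fun j => hw (B.equivFin.symm j))
  have h3 (t : α) : ∏ j, ∏ i ∈ (B.equivFin.symm j : Finset ι), ‖v t i‖ =
      ∏ T ∈ B, ∏ i ∈ T, ‖v t i‖ := by
    rw [B.equivFin.symm.prod_comp fun T : B => ∏ i ∈ (T : Finset ι), ‖v t i‖,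
      prod_coe_sort B fun T => ∏ i ∈ T, ‖v t i‖]
  simp_rw [h3] at h2
  simpa using (hg.finDiff_sub_isLittleO_of_cover hb hv hw h0 hB).add
    (h2.trans_isBigO (prod_prod_isBigO_of_cover hB hv))

end Cover

/-- A multilinear map approximating the finite differences of a function is symmetric. -/
theorem symmetric_of_finDiff_sub_isLittleO {n : ℕ} {f : X → Y} {x : X}
    {L : ContinuousMultilinearMap ℝ (fun _ : Fin n => X) Y}
    (h : (fun p : X × (Fin n → X) => finDiff f univ p.1 p.2 - L p.2)
      =o[𝓝 (x, 0)] fun p => ∏ i, ‖p.2 i‖) (v : Fin n → X) (σ : Equiv.Perm (Fin n)) :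
    L (v ∘ σ) = L v := by
  have ht (u : Fin n → X) : Tendsto (fun c : ℝ => (x, c • u)) (𝓝[≠] 0) (𝓝 (x, 0)) := by
    refine tendsto_const_nhds.prodMk_nhds ?_
    have : Tendsto (fun c : ℝ => c • u) (𝓝 0) (𝓝 ((0 : ℝ) • u)) := by
      exact (continuous_id.smul continuous_const).tendsto 0
    exact (zero_smul ℝ u ▸ this).mono_left nhdsWithin_le_nhds
  have hO (u : Fin n → X) : (fun c : ℝ => ∏ i, ‖(c • u) i‖) =O[𝓝[≠] 0] fun c => c ^ n := by
    refine IsBigO.of_bound (∏ i, ‖u i‖) (Eventually.of_forall fun c => ?_)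
    simp [norm_smul, prod_mul_distrib, mul_comm]
  have key (u : Fin n → X) := (h.comp_tendsto (ht u)).trans_isBigO (hO u)
  have hσ (c : ℝ) : finDiff f univ x (c • (v ∘ σ)) = finDiff f univ x (c • v) := by
    have := finDiff_map f σ.toEmbedding univ x (c • v)
    rw [map_univ_equiv] at this
    exact this.symm
  have h1 := (key v).sub (key (v ∘ σ))
  have h2 : (fun c : ℝ => c ^ n • (L (v ∘ σ) - L v)) =o[𝓝[≠] 0] fun c => c ^ n := by
    refine h1.congr_left fun c => ?_
    have hL (u : Fin n → X) : L (c • u) = c ^ n • L u := by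
      simpa [Pi.smul_def] using L.map_smul_univ (fun _ => c) u
    simp only [Function.comp_apply, hσ, hL, smul_sub]
    abel
  have h3 := (isBigO_refl (fun c : ℝ => (c ^ n)⁻¹) (𝓝[≠] 0)).smul_isLittleO h2
  have h4 : (fun _ : ℝ => L (v ∘ σ) - L v) =o[𝓝[≠] 0] fun _ => (1 : ℝ) := by
    refine h3.congr' ?_ ?_ <;> filter_upwards [self_mem_nhdsWithin] with c hc
    · rw [smul_smul, inv_mul_cancel₀ (pow_ne_zero n hc), one_smul]
    · rw [smul_eq_mul, inv_mul_cancel₀ (pow_ne_zero n hc)]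
  exact sub_eq_zero.1 (tendsto_nhds_unique tendsto_const_nhds ((isLittleO_one_iff ℝ).1 h4))

/-- The multilinear map attached to a partition in the Faà di Bruno formula. -/
theorem exists_multilinear_of_isHPartition [Fintype ι] [DecidableEq ι] {B : Finset (Finset ι)}
    (hB : IsHPartition B) (M : ContinuousMultilinearMap ℝ (fun _ : Fin #B => Y) Z)
    (D : ∀ k : ℕ, ContinuousMultilinearMap ℝ (fun _ : Fin k => X) Y) :
    ∃ L : ContinuousMultilinearMap ℝ (fun _ : ι => X) Z, ∀ v, L v = M fun j =>
      D #(B.equivFin.symm j : Finset ι) fun i =>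
        v ((B.equivFin.symm j : Finset ι).equivFin.symm i) := by
  let e : (Σ j : Fin #B, Fin #(B.equivFin.symm j : Finset ι)) → ι :=
    fun p => (B.equivFin.symm p.1 : Finset ι).equivFin.symm p.2
  have he : Function.Bijective e := by
    constructor
    · rintro ⟨j, i⟩ ⟨j', i'⟩ h
      obtain rfl : j = j' := by
        refine B.equivFin.symm.injective (Subtype.ext ((hB.2 (e ⟨j, i⟩)).unique ⟨?_, ?_⟩ ⟨?_, ?_⟩))
        · exact (B.equivFin.symm j).2
        · exact ((B.equivFin.symm j : Finset ι).equivFin.symm i).2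
        · exact (B.equivFin.symm j').2
        · rw [h]
          exact ((B.equivFin.symm j' : Finset ι).equivFin.symm i').2
      obtain rfl : i = i' := (Finset.equivFin _).symm.injective (Subtype.ext h)
      rfl
    · intro i
      obtain ⟨T, ⟨hT, hi⟩, -⟩ := hB.2 i
      obtain ⟨j, hj⟩ := B.equivFin.symm.surjective ⟨T, hT⟩
      obtain rfl : (B.equivFin.symm j : Finset ι) = T := by rw [hj]
      obtain ⟨k, hk⟩ := (Finset.equivFin _).symm.surjective
        (⟨i, hi⟩ : (B.equivFin.symm j : Finset ι))
      exact ⟨⟨j, k⟩, congrArg Subtype.val hk⟩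
  refine ⟨⟨(M.toMultilinearMap.compMultilinearMap fun j => (D _).toMultilinearMap).domDomCongr
    (Equiv.ofBijective e he), ?_⟩, fun v => rfl⟩
  change Continuous fun v : ι → X => M fun j =>
      D #(B.equivFin.symm j : Finset ι) fun i =>
        v ((B.equivFin.symm j : Finset ι).equivFin.symm i)
  fun_prop

end Asymptotic

open scoped Classical in
/-- **Theorem 1 (chain rule for the `n`-th strict Fréchet derivative).**
Let `X`, `Y`, `Z` be real Banach spaces, `U ⊆ X` open, `f : U → Y` with `f(U) ⊆ V ⊆ Y`,
`g : V → Z`, `x ∈ U`, `f x ∈ V`.  If for every `k ≤ n` the `k`-th strict Fréchet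
derivatives `f⁽ᵏ⁾(x)` and `g⁽ᵏ⁾(f x)` exist (finite-difference sense), then
`(g ∘ f)⁽ⁿ⁾(x)` exists and, for all vectors `(v_i)_{i∈I}` with `|I| = n`,
`⟨(g∘f)⁽ⁿ⁾(x), ⊗_{i∈I} v_i⟩
  = Σ_{π∈H(I)} ⟨g^{(|π|)}(f x), ⊗_{S∈π} ⟨f^{(|S|)}(x), ⊗_{i∈S} v_i⟩⟩`,
the sum running over all partitions `π` of `I` into nonempty subsets. -/
theorem stmt_0 {X Y Z : Type*}
    [NormedAddCommGroup X] [NormedSpace ℝ X] [CompleteSpace X]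
    [NormedAddCommGroup Y] [NormedSpace ℝ Y] [CompleteSpace Y]
    [NormedAddCommGroup Z] [NormedSpace ℝ Z] [CompleteSpace Z]
    (U : Set X) (hU : IsOpen U) (V : Set Y) (f : X → Y) (g : Y → Z)
    (hfUV : Set.MapsTo f U V) (x : X) (hx : x ∈ U) (hfx : f x ∈ V) (n : ℕ)
    (Df : ∀ k : ℕ, ContinuousMultilinearMap ℝ (fun _ : Fin k => X) Y)
    (Dg : ∀ k : ℕ, ContinuousMultilinearMap ℝ (fun _ : Fin k => Y) Z)
    (hf : ∀ k ≤ n, HasStrictFDerivAtOrder k f x (Df k))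
    (hg : ∀ k ≤ n, HasStrictFDerivAtOrder k g (f x) (Dg k)) :
    ∃ L : ContinuousMultilinearMap ℝ (fun _ : Fin n => X) Z,
      HasStrictFDerivAtOrder n (g ∘ f) x L ∧
      ∀ v : Fin n → X,
        L v =
          ∑ π ∈ Finset.univ.filter (fun π : Finset (Finset (Fin n)) => IsHPartition π),
            Dg π.card (fun j : Fin π.card =>
              Df ((π.equivFin.symm j : Finset (Fin n)).card) (fun i =>
                v (((π.equivFin.symm j : Finset (Fin n)).equivFin.symm i : Fin n)))) := by
  classical
  have hlin : ∀ B : Finset (Finset (Fin n)),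
      ∃ L : ContinuousMultilinearMap ℝ (fun _ : Fin n => X) Z,
      IsHPartition B → ∀ v, L v = Dg B.card fun j =>
        Df (B.equivFin.symm j : Finset (Fin n)).card fun i =>
          v ((B.equivFin.symm j : Finset (Fin n)).equivFin.symm i) := fun B => by
    by_cases hB : IsHPartition B
    · obtain ⟨L, hL⟩ := exists_multilinear_of_isHPartition hB (Dg B.card) Df
      exact ⟨L, fun _ => hL⟩
    · exact ⟨0, fun h => absurd h hB⟩
  choose M hM using hlin
  let L := ∑ π ∈ Finset.univ.filter (fun π : Finset (Finset (Fin n)) => IsHPartition π), M π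
  have hL (v : Fin n → X) : L v =
      ∑ π ∈ Finset.univ.filter (fun π : Finset (Finset (Fin n)) => IsHPartition π), M π v :=
    by simp [L]
  have key : (fun p : X × (Fin n → X) => finDiff (g ∘ f) Finset.univ p.1 p.2 - L p.2)
      =o[nhds (x, 0)] fun p => ∏ i, ‖p.2 i‖ := by
    have ha : Filter.Tendsto (Prod.fst : X × (Fin n → X) → X) (nhds (x, 0)) (nhds x) :=
      continuous_fst.tendsto _
    have hv (i : Fin n) : Filter.Tendsto (fun p : X × (Fin n → X) => p.2 i) (nhds (x, 0))
        (nhds 0) :=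
      ((continuous_apply i).comp continuous_snd).tendsto _
    have hcard (T : Finset (Fin n)) : T.card ≤ n := T.card_le_univ.trans_eq (Fintype.card_fin n)
    have hw (T : Finset (Fin n)) := (hf _ (hcard T)).finDiff_isBigO ha fun i _ => hv i
    have hw' (T : Finset (Fin n)) := (hf _ (hcard T)).finDiff_sub_isLittleO ha fun i _ => hv i
    have hb : Filter.Tendsto (fun p : X × (Fin n → X) => f p.1) (nhds (x, 0)) (nhds (f x)) :=
      (hf 0 n.zero_le).continuousAt.tendsto.comp ha
    have hsum (p : X × (Fin n → X)) : finDiff (g ∘ f) Finset.univ p.1 p.2 - L p.2 =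
        ∑ B : Finset (Finset (Fin n)) with ∅ ∉ B ∧ B.sup id = Finset.univ,
          (finDiff g B (f p.1) (fun T => finDiff f T p.1 p.2) -
            if IsHPartition B then M B p.2 else 0) := by
      rw [finDiff_comp, hL, Finset.sum_sub_distrib, ← Finset.sum_filter, Finset.filter_filter]
      congr 2
      ext B
      simp only [Finset.mem_filter, Finset.mem_univ, true_and, iff_and_self]
      refine fun hB => ⟨hB.1, Finset.eq_univ_iff_forall.2 fun i => ?_⟩
      obtain ⟨T, hT, -⟩ := hB.2 i
      exact Finset.mem_sup.2 ⟨T, hT⟩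
    simp_rw [hsum]
    refine IsLittleO.fun_sum fun B hB => ?_
    obtain ⟨h0, hsup⟩ := (Finset.mem_filter.1 hB).2
    have hcov (i : Fin n) : ∃ T ∈ B, i ∈ T := by
      simpa using Finset.mem_sup.1 (hsup ▸ Finset.mem_univ i)
    split_ifs with hP
    · simp_rw [hM B hP]
      refine finDiff_sub_isLittleO_of_cover (hg _ ?_) hb hv hw hw' h0 hcov
      simpa using hP.card_le
    · simp_rw [sub_zero]
      exact finDiff_isLittleO_of_not_partition (by simpa using hg) hb hv hw h0 hcov hP
  refine ⟨L, hasStrictFDerivAtOrder_isLittleO_iff.2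
    ⟨symmetric_of_finDiff_sub_isLittleO key, key⟩, fun v => ?_⟩
  rw [hL]
  exact Finset.sum_congr rfl fun π hπ => hM π (Finset.mem_filter.1 hπ).2 v
end

section
/- Let X, Y, Z be (real) Banach spaces, let f : X → Y be n times continuously differentiable on a neighborhood of a point x, and let g : Y → Z be n times continuously differentiable on a neighborhood of f(x). Then g ∘ f is n times differentiable at x and its n-th iterated Fréchet derivative satisfies, for all vectors v_1, …, v_n ∈ X: D^n(g∘f)(x)[v_1,…,v_n] = Σ_{π ∈ H({1,…,n})} D^{|π|}g(f(x))[ (D^{|S|}f(x)[(v_i)_{i∈S}])_{S∈π} ], the sum running over all partitions π of {1,…,n} into nonempty blocks. -/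
section Symmetry

variable {𝕜 : Type*} [RCLike 𝕜]
  {E : Type*} [NormedAddCommGroup E] [NormedSpace 𝕜 E]
  {F : Type*} [NormedAddCommGroup F] [NormedSpace 𝕜 F]

/-- The iterated derivative of order `n` is invariant under swapping its first two arguments. -/
theorem ContDiffAt.iteratedFDeriv_comp_swap_zero_one {n : ℕ} {f : E → F} {x : E}
    (hf : ContDiffAt 𝕜 (n + 2 : ℕ) f x) (v : Fin (n + 2) → E) :
    iteratedFDeriv 𝕜 (n + 2) f x (v ∘ Equiv.swap 0 1) = iteratedFDeriv 𝕜 (n + 2) f x v := by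
  have hC : ContDiffAt 𝕜 2 (iteratedFDeriv 𝕜 n f) x :=
    hf.iteratedFDeriv_right (by norm_cast; omega)
  have hsymm : IsSymmSndFDerivAt 𝕜 (iteratedFDeriv 𝕜 n f) x :=
    hC.isSymmSndFDerivAt (by simp)
  have key (w : Fin (n + 2) → E) : iteratedFDeriv 𝕜 (n + 2) f x w =
      fderiv 𝕜 (fderiv 𝕜 (iteratedFDeriv 𝕜 n f)) x (w 0) (w 1) (Fin.tail (Fin.tail w)) := by
    have hd : DifferentiableAt 𝕜 (iteratedFDeriv 𝕜 (n + 1) f) x :=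
      hf.differentiableAt_iteratedFDeriv (by norm_cast; omega)
    have hd' : DifferentiableAt 𝕜 (fderiv 𝕜 (iteratedFDeriv 𝕜 n f)) x :=
      (hC.fderiv_right (m := 1) (by norm_num)).differentiableAt (by norm_num)
    have happly := (hd'.hasFDerivAt.clm_apply
      (hasFDerivAt_const (w 1) x)).continuousMultilinear_apply_const (Fin.tail (Fin.tail w))
    rw [hd.iteratedFDeriv_succ_apply_left']
    refine (congrArg (fun L ↦ L (w 0)) happly.fderiv).trans ?_
    simp
  have htail : Fin.tail (Fin.tail (v ∘ Equiv.swap 0 1)) = Fin.tail (Fin.tail v) := by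
    ext i
    simp only [Fin.tail, Function.comp_apply]
    rw [Equiv.swap_apply_of_ne_of_ne (by simp) (by simp [Fin.ext_iff])]
  rw [key, key, htail]
  simp only [Function.comp_apply, Equiv.swap_apply_left, Equiv.swap_apply_right]
  rw [hsymm.eq]

/-- The iterated derivative of a `C^n` function is symmetric. -/
theorem ContDiffAt.iteratedFDeriv_comp_perm_of_nat {n : ℕ} {f : E → F} {x : E}
    (hf : ContDiffAt 𝕜 n f x) (σ : Equiv.Perm (Fin n)) (v : Fin n → E) :
    iteratedFDeriv 𝕜 n f x (v ∘ σ) = iteratedFDeriv 𝕜 n f x v := by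
  induction n generalizing x with
  | zero => rw [Subsingleton.elim (v ∘ σ) v]
  | succ n ih =>
    have hσ : σ ∈ Submonoid.closure
        (Set.range fun i : Fin n ↦ Equiv.swap i.castSucc i.succ) := by
      rw [Equiv.Perm.mclosure_swap_castSucc_succ]; trivial
    induction hσ using Submonoid.closure_induction generalizing v with
    | one => simp
    | mul σ τ _ _ hσ hτ =>
      rw [Equiv.Perm.coe_mul, ← Function.comp_assoc, hτ, hσ]
    | mem σ h =>
      obtain ⟨i, rfl⟩ := h
      obtain _ | n := n
      · exact i.elim0
      induction i using Fin.cases with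
      | zero => exact hf.iteratedFDeriv_comp_swap_zero_one v
      | succ i =>
        have hd : DifferentiableAt 𝕜 (iteratedFDeriv 𝕜 (n + 1) f) x :=
          hf.differentiableAt_iteratedFDeriv (by norm_cast; omega)
        rw [hd.iteratedFDeriv_succ_apply_left', hd.iteratedFDeriv_succ_apply_left']
        have h0 : Equiv.swap i.succ.castSucc i.succ.succ 0 = 0 :=
          Equiv.swap_apply_of_ne_of_ne (by simp [Fin.ext_iff]) (by simp [Fin.ext_iff])
        have htail : Fin.tail (v ∘ Equiv.swap i.succ.castSucc i.succ.succ) =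
            Fin.tail v ∘ Equiv.swap i.castSucc i.succ := by
          ext j
          simp only [Fin.tail, Function.comp_apply, Fin.castSucc_succ]
          rw [(Fin.succ_injective _).swap_apply]
        have hev : ∀ᶠ y in nhds x, ContDiffAt 𝕜 (n + 1 : ℕ) f y :=
          (hf.of_le (by norm_cast; omega)).eventually (by simp)
        rw [Function.comp_apply, h0, htail]
        congr 1
        exact Filter.EventuallyEq.fderiv_eq (hev.mono fun y hy ↦ ih hy _ _)

/-- The iterated derivative of order `#s` does not depend on the enumeration of `s` used to list
its arguments. -/
theorem ContDiffAt.iteratedFDeriv_equivFin_symm {k : ℕ} {f : E → F} {x : E}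
    (hf : ContDiffAt 𝕜 k f x) {α : Type*} {s : Finset α} (e : Fin k ≃ s) (w : α → E) :
    iteratedFDeriv 𝕜 s.card f x (fun i ↦ w (s.equivFin.symm i)) =
      iteratedFDeriv 𝕜 k f x (fun i ↦ w (e i)) := by
  obtain rfl : k = s.card := by simpa using Fintype.card_congr e
  rw [← hf.iteratedFDeriv_comp_perm_of_nat (s.equivFin.symm.trans e.symm) (fun i ↦ w (e i))]
  congr 1
  ext i
  simp

end Symmetry

namespace OrderedFinpartition

variable {n : ℕ} (c : OrderedFinpartition n)

/-- The `m`-th block of an ordered finpartition, as a finset. -/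
def block (m : Fin c.length) : Finset (Fin n) :=
  Finset.univ.map ⟨c.emb m, (c.emb_strictMono m).injective⟩

lemma mem_block {m : Fin c.length} {i : Fin n} : i ∈ c.block m ↔ ∃ r, c.emb m r = i := by
  simp [block]

lemma card_block (m : Fin c.length) : (c.block m).card = c.partSize m := by
  simp [block]

lemma emb_mem_block (m : Fin c.length) (r : Fin (c.partSize m)) : c.emb m r ∈ c.block m :=
  c.mem_block.2 ⟨r, rfl⟩

lemma eq_of_mem_block {m m' : Fin c.length} {i : Fin n} (h : i ∈ c.block m)
    (h' : i ∈ c.block m') : m = m' := by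
  obtain ⟨r, rfl⟩ := c.mem_block.1 h
  obtain ⟨r', hr'⟩ := c.mem_block.1 h'
  by_contra hne
  exact c.emb_ne_emb_of_ne hne hr'.symm

lemma block_injective : Function.Injective c.block := fun m _ h ↦
  c.eq_of_mem_block (c.emb_mem_block m ⟨0, c.partSize_pos m⟩)
    (h ▸ c.emb_mem_block m ⟨0, c.partSize_pos m⟩)

/-- The unordered set of blocks of an ordered finpartition. -/
def blocks : Finset (Finset (Fin n)) :=
  Finset.univ.map ⟨c.block, c.block_injective⟩

lemma mem_blocks {S : Finset (Fin n)} : S ∈ c.blocks ↔ ∃ m, c.block m = S := by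
  simp [blocks]

lemma card_blocks : c.blocks.card = c.length := by
  simp [blocks]

lemma isHPartition_blocks [DecidableEq (Fin n)] : IsHPartition c.blocks := by
  refine ⟨fun h ↦ ?_, fun i ↦ ?_⟩
  · obtain ⟨m, hm⟩ := c.mem_blocks.1 h
    simpa [hm] using c.emb_mem_block m ⟨0, c.partSize_pos m⟩
  · obtain ⟨m, hm⟩ := c.cover i
    refine ⟨c.block m, ⟨c.mem_blocks.2 ⟨m, rfl⟩, c.mem_block.2 hm⟩, ?_⟩
    rintro _ ⟨hS, hi⟩
    obtain ⟨m', rfl⟩ := c.mem_blocks.1 hS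
    rw [c.eq_of_mem_block hi (c.mem_block.2 hm)]

/-- The parameterization of the `m`-th block. -/
noncomputable def blockEquiv (m : Fin c.length) : Fin (c.partSize m) ≃ c.block m :=
  Equiv.ofBijective (fun r ↦ ⟨c.emb m r, c.emb_mem_block m r⟩)
    ⟨fun _ _ h ↦ (c.emb_strictMono m).injective (Subtype.ext_iff.1 h),
      fun ⟨_, hi⟩ ↦ (c.mem_block.1 hi).imp fun _ h ↦ Subtype.ext h⟩

/-- The enumeration of the blocks. -/
noncomputable def blocksEquiv : Fin c.length ≃ c.blocks :=
  Equiv.ofBijective (fun m ↦ ⟨c.block m, c.mem_blocks.2 ⟨m, rfl⟩⟩)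
    ⟨fun _ _ h ↦ c.block_injective (Subtype.ext_iff.1 h),
      fun ⟨_, hS⟩ ↦ (c.mem_blocks.1 hS).imp fun _ h ↦ Subtype.ext h⟩

/-- The greatest element of the `m`-th block. -/
def blockMax (m : Fin c.length) : Fin n :=
  c.emb m ⟨c.partSize m - 1, Nat.sub_one_lt_of_lt (c.partSize_pos m)⟩

lemma blockMax_mem (m : Fin c.length) : c.blockMax m ∈ c.block m := c.emb_mem_block m _

lemma le_blockMax {m : Fin c.length} {i : Fin n} (hi : i ∈ c.block m) : i ≤ c.blockMax m := by
  obtain ⟨r, rfl⟩ := c.mem_block.1 hi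
  exact (c.emb_strictMono m).monotone (Fin.mk_le_mk.2 (by have := r.2; omega))

lemma range_blockMax :
    Set.range c.blockMax = {a | ∃ S ∈ c.blocks, a ∈ S ∧ ∀ b ∈ S, b ≤ a} := by
  ext a
  constructor
  · rintro ⟨m, rfl⟩
    exact ⟨c.block m, c.mem_blocks.2 ⟨m, rfl⟩, c.blockMax_mem m, fun b ↦ c.le_blockMax⟩
  · rintro ⟨S, hS, ha, hmax⟩
    obtain ⟨m, rfl⟩ := c.mem_blocks.1 hS
    exact ⟨m, le_antisymm (hmax _ (c.blockMax_mem m)) (c.le_blockMax ha)⟩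

lemma blocks_injective : Function.Injective (blocks (n := n)) := by
  intro c d h
  have hblock : ∀ {m : Fin c.length} {m' : Fin d.length}, c.blockMax m = d.blockMax m' →
      c.block m = d.block m' := fun {m m'} hm ↦ by
    obtain ⟨m'', hm''⟩ := d.mem_blocks.1 (h ▸ c.mem_blocks.2 ⟨m, rfl⟩)
    have hmem : d.blockMax m' ∈ d.block m'' := by
      rw [hm'', ← hm]
      exact c.blockMax_mem m
    rw [← hm'', d.eq_of_mem_block hmem (d.blockMax_mem m')]
  have hlen : c.length = d.length := by rw [← c.card_blocks, h, d.card_blocks]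
  have hrange : Set.range c.blockMax = Set.range d.blockMax := by
    rw [c.range_blockMax, d.range_blockMax, h]
  have hc := c.parts_strictMono
  have hd := d.parts_strictMono
  change StrictMono c.blockMax at hc
  change StrictMono d.blockMax at hd
  have hmax : ∀ m, c.blockMax m = d.blockMax (Fin.cast hlen m) := by
    refine congrFun ((hc.range_inj (hd.comp (Fin.castOrderIso hlen).strictMono)).1 ?_)
    rw [hrange]
    exact ((Fin.castOrderIso hlen).surjective.range_comp _).symm
  have hb : ∀ m, c.block m = d.block (Fin.cast hlen m) := fun m ↦ hblock (hmax m)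
  have hsize : ∀ m, c.partSize m = d.partSize (Fin.cast hlen m) := fun m ↦ by
    rw [← c.card_block, ← d.card_block, hb]
  have hemb : ∀ m r, c.emb m r = d.emb (Fin.cast hlen m) (Fin.cast (hsize m) r) := fun m ↦ by
    refine congrFun (((c.emb_strictMono m).range_inj
      ((d.emb_strictMono _).comp (Fin.castOrderIso (hsize m)).strictMono)).1 ?_)
    rw [(Fin.castOrderIso (hsize m)).surjective.range_comp]
    ext i
    rw [Set.mem_range, Set.mem_range, ← mem_block, ← mem_block, hb]
  clear hc hd hmax hb hblock hrange h
  obtain ⟨k, p, _, e, _, _, _, _⟩ := c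
  obtain ⟨k', p', _, e', _, _, _, _⟩ := d
  obtain rfl : k = k' := hlen
  obtain rfl : p = p' := funext hsize
  obtain rfl : e = e' := funext fun m ↦ funext fun r ↦ hemb m r
  rfl

end OrderedFinpartition

lemma IsHPartition.eq_of_mem {ι : Type*} [DecidableEq ι] {π : Finset (Finset ι)}
    (hπ : IsHPartition π) {S T : Finset ι} (hS : S ∈ π) (hT : T ∈ π) {i : ι} (hiS : i ∈ S)
    (hiT : i ∈ T) : S = T :=
  (hπ.2 i).unique ⟨hS, hiS⟩ ⟨hT, hiT⟩

lemma IsHPartition.exists_blocks_eq {n : ℕ} [DecidableEq (Fin n)] {π : Finset (Finset (Fin n))}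
    (hπ : IsHPartition π) : ∃ c : OrderedFinpartition n, c.blocks = π := by
  classical
  choose B hB _ using hπ.2
  have hBmem : ∀ i, B i ∈ π := fun i ↦ (hB i).1
  have hself : ∀ i, i ∈ B i := fun i ↦ (hB i).2
  have hBeq : ∀ {i j}, i ∈ B j → B i = B j := fun {i j} h ↦
    hπ.eq_of_mem (hBmem i) (hBmem j) (hself i) h
  let A : Finset (Fin n) := {a | ∀ b ∈ B a, b ≤ a}
  have hA : ∀ {a}, a ∈ A ↔ ∀ b ∈ B a, b ≤ a := by simp [A]
  have hcover : ∀ i, ∃ a ∈ A, B a = B i := fun i ↦ by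
    have hmem := (B i).max'_mem ⟨i, hself i⟩
    refine ⟨_, hA.2 fun b hb ↦ ?_, hBeq hmem⟩
    exact (B i).le_max' b (hBeq hmem ▸ hb)
  let a : Fin A.card ↪o Fin n := A.orderEmbOfFin rfl
  have haA : ∀ m, a m ∈ A := A.orderEmbOfFin_mem rfl
  have ha_surj : ∀ {b}, b ∈ A → ∃ m, a m = b := fun {b} hb ↦ by
    have : b ∈ Set.range a := by rw [A.range_orderEmbOfFin rfl]; exact hb
    exact this
  have hpos : ∀ m, 0 < (B (a m)).card := fun m ↦ Finset.card_pos.2 ⟨_, hself _⟩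
  have hrange : ∀ m, Set.range ((B (a m)).orderEmbOfFin rfl) = B (a m) := fun m ↦
    (B (a m)).range_orderEmbOfFin rfl
  have hlast : ∀ m, (B (a m)).orderEmbOfFin rfl
      ⟨(B (a m)).card - 1, Nat.sub_one_lt_of_lt (hpos m)⟩ = a m := fun m ↦ by
    rw [Finset.orderEmbOfFin_last rfl (hpos m)]
    exact le_antisymm (hA.1 (haA m) _ (Finset.max'_mem _ _)) (Finset.le_max' _ _ (hself _))
  let c : OrderedFinpartition n :=
    { length := A.card
      partSize := fun m ↦ (B (a m)).card
      partSize_pos := hpos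
      emb := fun m ↦ (B (a m)).orderEmbOfFin rfl
      emb_strictMono := fun m ↦ ((B (a m)).orderEmbOfFin rfl).strictMono
      parts_strictMono := by
        simp only [hlast]
        exact a.strictMono
      disjoint := by
        intro m _ m' _ hne
        simp only [Function.onFun, hrange, Set.disjoint_left, Finset.mem_coe]
        intro i hi hi'
        have heq : B (a m) = B (a m') := (hBeq hi).symm.trans (hBeq hi')
        exact hne (a.injective (le_antisymm (hA.1 (haA m') _ (heq ▸ hself _))
          (hA.1 (haA m) _ (heq ▸ hself _))))
      cover := by
        intro i
        obtain ⟨b, hb, hbi⟩ := hcover i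
        obtain ⟨m, rfl⟩ := ha_surj hb
        refine ⟨m, ?_⟩
        rw [hrange, hbi]
        exact hself i }
  have hc : ∀ m, c.block m = B (a m) := fun m ↦ by
    ext i
    rw [OrderedFinpartition.mem_block, ← Finset.mem_coe, ← hrange]
    rfl
  refine ⟨c, ?_⟩
  ext S
  rw [OrderedFinpartition.mem_blocks]
  constructor
  · rintro ⟨m, rfl⟩
    exact hc m ▸ hBmem _
  · intro hS
    obtain ⟨i, hi⟩ := Finset.nonempty_iff_ne_empty.2 fun h ↦ hπ.1 (h ▸ hS)
    obtain ⟨b, hb, hbi⟩ := hcover i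
    obtain ⟨m, rfl⟩ := ha_surj hb
    exact ⟨m, (hc m).trans (hbi.trans (hπ.eq_of_mem (hBmem i) hS (hself i) hi))⟩

open scoped Classical in
/-- **Faà di Bruno formula for iterated Fréchet derivatives.**  If `f : X → Y` is `n` times
continuously differentiable on a neighborhood of `x` and `g : Y → Z` is `n` times
continuously differentiable on a neighborhood of `f x` (`X`, `Y`, `Z` real Banach spaces),
then `g ∘ f` is `n` times differentiable at `x` and for all `v_1, …, v_n ∈ X`:
`Dⁿ(g∘f)(x)[v_1,…,v_n]
  = Σ_{π ∈ H({1,…,n})} D^{|π|}g(f x)[(D^{|S|}f(x)[(v_i)_{i∈S}])_{S∈π}]`,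
the sum running over all partitions `π` of `{1,…,n}` into nonempty blocks. -/
theorem stmt_1 {X Y Z : Type*}
    [NormedAddCommGroup X] [NormedSpace ℝ X] [CompleteSpace X]
    [NormedAddCommGroup Y] [NormedSpace ℝ Y] [CompleteSpace Y]
    [NormedAddCommGroup Z] [NormedSpace ℝ Z] [CompleteSpace Z]
    (n : ℕ) (f : X → Y) (g : Y → Z) (x : X)
    (hf : ∃ u ∈ nhds x, ContDiffOn ℝ n f u)
    (hg : ∃ w ∈ nhds (f x), ContDiffOn ℝ n g w) :
    ContDiffAt ℝ n (g ∘ f) x ∧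
    ∀ v : Fin n → X,
      iteratedFDeriv ℝ n (g ∘ f) x v =
        ∑ π ∈ Finset.univ.filter (fun π : Finset (Finset (Fin n)) => IsHPartition π),
          iteratedFDeriv ℝ π.card g (f x) (fun j : Fin π.card =>
            iteratedFDeriv ℝ ((π.equivFin.symm j : Finset (Fin n)).card) f x (fun i =>
              v (((π.equivFin.symm j : Finset (Fin n)).equivFin.symm i : Fin n)))) := by
  have hfx : ContDiffAt ℝ n f x := by
    obtain ⟨u, hu, hfu⟩ := hf
    exact hfu.contDiffAt hu
  have hgx : ContDiffAt ℝ n g (f x) := by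
    obtain ⟨w, hw, hgw⟩ := hg
    exact hgw.contDiffAt hw
  refine ⟨hgx.comp x hfx, fun v ↦ ?_⟩
  rw [iteratedFDeriv_comp hgx hfx le_rfl, FormalMultilinearSeries.taylorComp, sum_apply]
  refine Finset.sum_bij (fun c _ ↦ c.blocks)
    (fun c _ ↦ Finset.mem_filter.2 ⟨Finset.mem_univ _, c.isHPartition_blocks⟩)
    (fun c _ d _ h ↦ OrderedFinpartition.blocks_injective h)
    (fun π hπ ↦ ?_) (fun c _ ↦ ?_)
  · obtain ⟨c, hc⟩ := (Finset.mem_filter.1 hπ).2.exists_blocks_eq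
    exact ⟨c, Finset.mem_univ _, hc⟩
  · rw [(hgx.of_le (by exact_mod_cast c.length_le)).iteratedFDeriv_equivFin_symm c.blocksEquiv
      (fun S ↦ iteratedFDeriv ℝ S.card f x fun i ↦ v (S.equivFin.symm i))]
    rw [FormalMultilinearSeries.compAlongOrderedFinpartition_apply]
    refine congrArg (iteratedFDeriv ℝ c.length g (f x)) (funext fun m ↦ ?_)
    exact ((hfx.of_le (by exact_mod_cast c.partSize_le m)).iteratedFDeriv_equivFin_symm
      (c.blockEquiv m) v).symm
end

section
/- Let X, Y be (real) Banach spaces, f a map defined on a neighborhood of x ∈ X with values in Y, and n ∈ ℕ. Suppose f has an n-th strict Fréchet derivative f^(n)(x) at x (finite-difference sense). Let I be a finite index set with |I| > n and let J ⊆ I with |J| = n. Then Σ_{S⊆I} (−1)^{|I|−|S|} f(v̄ + Σ_{i∈S} v_i) = o(∏_{i∈J} ‖v_i‖) as v̄ → x and all v_i (i ∈ I) → 0 jointly. -/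
open Asymptotics

theorem Finset.exists_univ_fin_map_eq {ι : Type*} (J : Finset ι) {n : ℕ} (hJ : J.card = n) :
    ∃ e : Fin n ↪ ι, Finset.univ.map e = J := by
  refine ⟨(J.equivFinOfCardEq hJ).symm.toEmbedding.trans (Function.Embedding.subtype _), ?_⟩
  rw [← Finset.map_map, Finset.map_univ_equiv]
  exact J.attach_map_val

/-- Every subset of `ι` splits uniquely into a part inside the range of `e` and a part outside. -/
theorem Finset.sum_univ_eq_sum_powerset_compl_map {ι κ M : Type*} [Fintype ι] [DecidableEq ι]
    [Fintype κ] [AddCommMonoid M] (e : κ ↪ ι) (F : Finset ι → M) :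
    ∑ S : Finset ι, F S =
      ∑ B ∈ (Finset.univ.map e)ᶜ.powerset, ∑ A : Finset κ, F (A.map e ∪ B) := by
  rw [← Finset.sum_product']
  symm
  refine Finset.sum_nbij' (fun q => q.2.map e ∪ q.1)
    (fun S => (S \ Finset.univ.map e, Finset.univ.filter (fun k => e k ∈ S))) ?_ ?_ ?_ ?_ ?_
  · simp
  · intro S _
    simp only [Finset.mem_product, Finset.mem_powerset, Finset.mem_univ, and_true]
    intro i hi
    simp_all
  · rintro ⟨B, A⟩ h
    simp only [Finset.mem_product, Finset.mem_powerset, Finset.mem_univ, and_true] at h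
    have hB : ∀ k, e k ∉ B := fun k hk => by simpa using h hk
    ext i
    · simp only [Finset.mem_sdiff, Finset.mem_union, Finset.mem_map, Finset.mem_univ, true_and]
      constructor
      · rintro ⟨⟨k, _, rfl⟩ | hi, h'⟩
        · exact absurd ⟨k, rfl⟩ h'
        · exact hi
      · intro hi
        refine ⟨Or.inr hi, ?_⟩
        rintro ⟨k, rfl⟩
        exact hB k hi
    · simp [hB]
  · intro S _
    ext i
    simp only [Finset.mem_sdiff, Finset.mem_union, Finset.mem_map, Finset.mem_univ, true_and,
      Finset.mem_filter]
    constructor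
    · rintro (⟨k, hk, rfl⟩ | hi)
      · exact hk
      · exact hi.1
    · intro hi
      by_cases h : ∃ k, e k = i
      · obtain ⟨k, rfl⟩ := h
        exact Or.inl ⟨k, hi, rfl⟩
      · exact Or.inr ⟨hi, h⟩
  · simp

theorem Finset.sum_powerset_neg_one_pow_card_sub_card {ι : Type*} {s : Finset ι}
    (hs : s.Nonempty) : ∑ B ∈ s.powerset, (-1 : ℝ) ^ (s.card - B.card) = 0 := by
  have h := Finset.sum_pow_mul_eq_add_pow (1 : ℝ) (-1) s
  simpa [hs.card_ne_zero] using h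

/-- **Lemma 1.** If `f` (a map between real Banach spaces) has an `n`-th strict Fréchet
derivative at `x` and `I` is a finite index set with `|I| > n`, then for any `J ⊆ I` with
`|J| = n`, `Σ_{S⊆I} (−1)^{|I|−|S|} f(v̄ + Σ_{i∈S} v_i) = o(∏_{i∈J} ‖v_i‖)` as `v̄ → x` and
all `v_i → 0` (`i ∈ I`) jointly. -/
theorem stmt_2 {X Y : Type*} [NormedAddCommGroup X] [NormedSpace ℝ X] [CompleteSpace X]
    [NormedAddCommGroup Y] [NormedSpace ℝ Y] [CompleteSpace Y]
    (n : ℕ) (f : X → Y) (x : X)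
    (hf : ∃ L : ContinuousMultilinearMap ℝ (fun _ : Fin n => X) Y,
      HasStrictFDerivAtOrder n f x L)
    {ι : Type*} [Fintype ι] [DecidableEq ι] (hI : n < Fintype.card ι)
    (J : Finset ι) (hJ : J.card = n) :
    (fun p : X × (ι → X) =>
        ∑ S : Finset ι, ((-1 : ℝ) ^ (Fintype.card ι - S.card)) • f (p.1 + ∑ i ∈ S, p.2 i))
      =o[nhds (x, 0)] (fun p : X × (ι → X) => ∏ i ∈ J, ‖p.2 i‖) := by
  obtain ⟨L, -, hL⟩ := hf
  obtain ⟨e, rfl⟩ := J.exists_univ_fin_map_eq hJ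
  set K : Finset ι := (Finset.univ.map e)ᶜ with hK
  have hcard : K.card + n = Fintype.card ι := by
    rw [hK, ← Finset.card_compl_add_card (Finset.univ.map e), hJ]
  have hKne : K.Nonempty := Finset.card_pos.1 (by omega)
  have hsum : ∀ p : X × (ι → X),
      ∑ S : Finset ι, ((-1 : ℝ) ^ (Fintype.card ι - S.card)) • f (p.1 + ∑ i ∈ S, p.2 i) =
      ∑ B ∈ K.powerset, ((-1 : ℝ) ^ (K.card - B.card)) •
        ((∑ A : Finset (Fin n), ((-1 : ℝ) ^ (n - A.card)) •
          f ((p.1 + ∑ i ∈ B, p.2 i) + ∑ k ∈ A, p.2 (e k))) - L (fun k => p.2 (e k))) := by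
    intro p
    simp only [smul_sub, Finset.sum_sub_distrib]
    rw [← Finset.sum_smul, Finset.sum_powerset_neg_one_pow_card_sub_card hKne, zero_smul,
      sub_zero, Finset.sum_univ_eq_sum_powerset_compl_map e]
    refine Finset.sum_congr rfl fun B hB => ?_
    rw [Finset.smul_sum]
    refine Finset.sum_congr rfl fun A _ => ?_
    have hBK : B ⊆ K := Finset.mem_powerset.1 hB
    have hdisj : Disjoint (A.map e) B := by
      refine Disjoint.mono (Finset.map_subset_map.2 (Finset.subset_univ A)) hBK ?_
      exact disjoint_compl_right
    have hBc := Finset.card_le_card hBK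
    have hAc : A.card ≤ n := by simpa using Finset.card_le_univ A
    rw [Finset.card_union_of_disjoint hdisj, Finset.sum_union hdisj, Finset.sum_map,
      Finset.card_map, smul_smul, ← pow_add, add_assoc p.1, add_comm (∑ i ∈ B, p.2 i)]
    congr 2
    omega
  simp only [hsum, Finset.prod_map]
  apply IsLittleO.fun_sum
  intro B _
  have hcont : Filter.Tendsto
      (fun p : X × (ι → X) => (p.1 + ∑ i ∈ B, p.2 i, fun k : Fin n => p.2 (e k)))
      (nhds (x, 0)) (nhds (x, 0)) := by
    have hc : Continuous
        (fun p : X × (ι → X) => (p.1 + ∑ i ∈ B, p.2 i, fun k : Fin n => p.2 (e k))) := by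
      fun_prop
    convert hc.tendsto (x, 0) using 2
    simp [Pi.zero_def]
  exact (hL.comp_tendsto hcont).const_smul_left _
end

section
/- Let X be an additive commutative group (e.g. a real vector space), let ℰX denote the group algebra of X over ℝ with canonical basis (ℰx)_{x∈X} and multiplication ℰx·ℰy = ℰ(x+y), and let ℰℰX denote the group algebra of the additive group ℰX, with canonical embedding a ↦ ℰa. Then for any finite set I and elements v̄, (v_i)_{i∈I} of X, the following identity holds in ℰℰX: Σ_{S⊆I} (−1)^{|I|−|S|} ℰℰ(v̄ + Σ_{i∈S} v_i) = Σ_{α} ℰℰv̄ · ∏_{A∈α} ( ℰ[ ℰv̄ · ∏_{i∈A}(ℰv_i − 1) ] − 1 ), where the right-hand sum runs over all families α of subsets of I such that ∅ ∉ α and ∪α = I (i.e. all covers of I by nonempty subsets, without repetition). -/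
/-- The canonical basis map `ℰ : X → ℰX` of the group algebra `ℰX = AddMonoidAlgebra ℝ X`,
sending `x` to the basis element `ℰx = single x 1`. -/
noncomputable def calE {X : Type*} [AddCommGroup X] (x : X) : AddMonoidAlgebra ℝ X :=
  AddMonoidAlgebra.single x 1

/-- The canonical basis map `ℰ : ℰX → ℰℰX` of the iterated group algebra
`ℰℰX = AddMonoidAlgebra ℝ (ℰX)`, sending `a ∈ ℰX` to the basis element `ℰa = single a 1`. -/
noncomputable def calE₂ {X : Type*} [AddCommGroup X] (a : AddMonoidAlgebra ℝ X) :
    AddMonoidAlgebra ℝ (AddMonoidAlgebra ℝ X) :=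
  AddMonoidAlgebra.single a 1

theorem calE_add {X : Type*} [AddCommGroup X] (x y : X) : calE (x + y) = calE x * calE y := by
  simp [calE, AddMonoidAlgebra.single_mul_single]

theorem calE_sum {X : Type*} [AddCommGroup X] {ι : Type*} (S : Finset ι) (v : ι → X) :
    calE (∑ i ∈ S, v i) = ∏ i ∈ S, calE (v i) := by
  classical
  induction S using Finset.induction_on with
  | empty => rfl
  | insert a s ha ih => rw [Finset.sum_insert ha, Finset.prod_insert ha, calE_add, ih]

theorem calE₂_sum {X : Type*} [AddCommGroup X] {κ : Type*} (S : Finset κ)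
    (a : κ → AddMonoidAlgebra ℝ X) : calE₂ (∑ i ∈ S, a i) = ∏ i ∈ S, calE₂ (a i) :=
  calE_sum S a

/-- Expansion of `ℰ(v̄ + Σ_{i∈S} v_i)` in products of the differences `ℰv_i - 1`. -/
theorem calE_add_sum {X : Type*} [AddCommGroup X] {ι : Type*} [DecidableEq ι] (vbar : X)
    (v : ι → X) (S : Finset ι) :
    calE (vbar + ∑ i ∈ S, v i) =
      ∑ A ∈ S.powerset, calE vbar * ∏ i ∈ A, (calE (v i) - 1) := by
  rw [calE_add, calE_sum, ← Finset.mul_sum, ← Finset.prod_add_one]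
  simp

/-- The alternating sum over the supersets of `U` vanishes unless `U` is everything. -/
theorem sum_supersets_neg_one_pow {ι : Type*} [Fintype ι] [DecidableEq ι] (U : Finset ι) :
    ∑ S : Finset ι with U ⊆ S, (-1 : ℝ) ^ (Fintype.card ι - S.card) =
      if U = Finset.univ then 1 else 0 := by
  have h : ∑ S : Finset ι with U ⊆ S, (-1 : ℝ) ^ (Fintype.card ι - S.card) =
      ∑ T ∈ Uᶜ.powerset, (-1 : ℝ) ^ T.card := by
    refine Finset.sum_nbij' compl compl ?_ ?_ ?_ ?_ ?_
    · simp
    · intro T hT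
      simpa using Finset.subset_compl_comm.1 (Finset.mem_powerset.1 hT)
    · simp
    · simp
    · simp [Finset.card_compl]
  have h2 := congrArg (Int.cast : ℤ → ℝ) (Finset.sum_powerset_neg_one_pow_card (x := Uᶜ))
  push_cast at h2
  rw [h, h2]
  simp [Finset.compl_eq_empty_iff]

/-- **Lemma 2.** In `ℰℰX`, for any finite index set `I` and elements `v̄`, `(v_i)_{i∈I}` of `X`:
`Σ_{S⊆I} (−1)^{|I|−|S|} ℰℰ(v̄ + Σ_{i∈S} v_i)
  = Σ_{α ⊆ 𝒫(I), ∪α = I, ∅ ∉ α} ℰℰv̄ · ∏_{A∈α} (ℰ[ℰv̄ · ∏_{i∈A}(ℰv_i − 1)] − 1)`,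
the right-hand sum running over all covers of `I` by nonempty subsets (without repetition). -/
theorem stmt_3 {X : Type*} [AddCommGroup X] {ι : Type*} [Fintype ι] [DecidableEq ι]
    (vbar : X) (v : ι → X) :
    (∑ S : Finset ι, ((-1 : ℝ) ^ (Fintype.card ι - S.card)) •
        calE₂ (calE (vbar + ∑ i ∈ S, v i))) =
      ∑ α ∈ Finset.univ.filter
          (fun α : Finset (Finset ι) => ∅ ∉ α ∧ α.sup id = Finset.univ),
        calE₂ (calE vbar) *
          ∏ A ∈ α, (calE₂ (calE vbar * ∏ i ∈ A, (calE (v i) - 1)) - 1) := by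
  set f : Finset ι → AddMonoidAlgebra ℝ (AddMonoidAlgebra ℝ X) :=
    fun A => calE₂ (calE vbar * ∏ i ∈ A, (calE (v i) - 1)) - 1 with hf
  have key (S : Finset ι) : calE₂ (calE (vbar + ∑ i ∈ S, v i)) =
      ∑ α : Finset (Finset ι), if ∅ ∉ α ∧ α.sup id ⊆ S then
        calE₂ (calE vbar) * ∏ A ∈ α, f A else 0 := by
    rw [calE_add_sum, calE₂_sum, ← Finset.mul_prod_erase _ _ (Finset.empty_mem_powerset S),
      Finset.prod_empty, mul_one]
    have h : ∏ A ∈ S.powerset.erase ∅, calE₂ (calE vbar * ∏ i ∈ A, (calE (v i) - 1)) =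
        ∏ A ∈ S.powerset.erase ∅, (f A + 1) := by simp [hf]
    rw [h, Finset.prod_add_one, Finset.mul_sum, ← Finset.sum_filter]
    refine Finset.sum_congr ?_ fun _ _ => rfl
    ext α
    simp only [Finset.mem_powerset, Finset.mem_filter, Finset.mem_univ, true_and,
      Finset.subset_erase, Finset.sup_le_iff, id]
    rw [and_comm]
    simp [Finset.subset_iff (s₁ := α)]
  simp_rw [key, Finset.smul_sum]
  rw [Finset.sum_comm, Finset.sum_filter]
  refine Finset.sum_congr rfl fun α _ => ?_
  by_cases hα : ∅ ∈ α
  · simp [hα]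
  · simp only [hα, not_false_eq_true, true_and, smul_ite, smul_zero]
    rw [← Finset.sum_filter, ← Finset.sum_smul, sum_supersets_neg_one_pow, ite_smul, one_smul,
      zero_smul]
end

section
/- Let X be a real normed space, I a finite set, and α a family of nonempty subsets of I with ∪α = I which is not a partition of I (equivalently, Σ_{A∈α} |A| > |I|, i.e. the members of α cover I with redundancy). Then ∏_{A∈α} ∏_{i∈A} ‖v_i‖ = o(∏_{i∈I} ‖v_i‖) as all v_i → 0 (i ∈ I); that is, for every ε > 0 there is δ > 0 such that ‖v_i‖ ≤ δ for all i ∈ I implies ∏_{A∈α} ∏_{i∈A} ‖v_i‖ ≤ ε · ∏_{i∈I} ‖v_i‖. -/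
/-- A product over the members of a family of finsets collects each factor with its multiplicity. -/
theorem Finset.prod_prod_eq_prod_pow_card_filter_mem {ι M : Type*} [Fintype ι] [DecidableEq ι]
    [CommMonoid M] (α : Finset (Finset ι)) (f : ι → M) :
    ∏ A ∈ α, ∏ i ∈ A, f i = ∏ i, f i ^ (α.filter (i ∈ ·)).card := by
  rw [Finset.prod_comm' (t' := Finset.univ) (s' := fun i => α.filter (i ∈ ·)) (by simp)]
  simp

/-- If every exponent is positive and some exponent is at least two, then the product of powers of
numbers in `[0, δ]`, with `δ ≤ 1`, is at most `δ` times the product of the numbers. -/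
theorem Finset.prod_pow_le_mul_prod {ι : Type*} [Fintype ι] {δ : ℝ} (hδ : δ ≤ 1) {x : ι → ℝ}
    (hx₀ : ∀ i, 0 ≤ x i) (hx : ∀ i, x i ≤ δ) {m : ι → ℕ} (hm : ∀ i, 1 ≤ m i)
    {j : ι} (hj : 2 ≤ m j) : ∏ i, x i ^ m i ≤ δ * ∏ i, x i := by
  classical
  have hx₁ (i : ι) : x i ≤ 1 := (hx i).trans hδ
  rw [← Finset.mul_prod_erase _ _ (Finset.mem_univ j),
    ← Finset.mul_prod_erase _ _ (Finset.mem_univ j), ← mul_assoc]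
  have hδ₀ : 0 ≤ δ := (hx₀ j).trans (hx j)
  refine mul_le_mul ?_ ?_ (Finset.prod_nonneg fun i _ => pow_nonneg (hx₀ i) _)
    (mul_nonneg hδ₀ (hx₀ j))
  · calc x j ^ m j ≤ x j ^ 2 := pow_le_pow_of_le_one (hx₀ j) (hx₁ j) hj
      _ = x j * x j := sq _
      _ ≤ δ * x j := mul_le_mul_of_nonneg_right (hx j) (hx₀ j)
  · exact Finset.prod_le_prod (fun i _ => pow_nonneg (hx₀ i) _) fun i _ =>
      pow_le_of_le_one (hx₀ i) (hx₁ i) (by have := hm i; lia)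

/-- If `α` is a family of nonempty subsets of a finite set `I` covering `I` with redundancy
(i.e. `∪α = I` but `Σ_{A∈α} |A| > |I|`, so `α` is not a partition), then
`∏_{A∈α} ∏_{i∈A} ‖v_i‖ = o(∏_{i∈I} ‖v_i‖)` as all `v_i → 0`: for every `ε > 0` there is
`δ > 0` such that `‖v_i‖ ≤ δ` for all `i ∈ I` implies
`∏_{A∈α} ∏_{i∈A} ‖v_i‖ ≤ ε · ∏_{i∈I} ‖v_i‖`. -/
theorem stmt_6 {X : Type*} [NormedAddCommGroup X] [NormedSpace ℝ X]
    {ι : Type*} [Fintype ι] [DecidableEq ι]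
    (α : Finset (Finset ι)) (hne : ∅ ∉ α) (hcover : α.sup id = Finset.univ)
    (hredundant : Fintype.card ι < ∑ A ∈ α, A.card) :
    ∀ ε : ℝ, 0 < ε → ∃ δ : ℝ, 0 < δ ∧ ∀ v : ι → X, (∀ i : ι, ‖v i‖ ≤ δ) →
      (∏ A ∈ α, ∏ i ∈ A, ‖v i‖) ≤ ε * ∏ i : ι, ‖v i‖ := by
  have hm (i : ι) : 1 ≤ (α.filter (i ∈ ·)).card := by
    have hi : i ∈ α.sup id := hcover ▸ Finset.mem_univ i
    obtain ⟨A, hA, hiA⟩ := Finset.mem_sup.1 hi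
    exact Finset.card_pos.2 ⟨A, Finset.mem_filter.2 ⟨hA, hiA⟩⟩
  obtain ⟨j, hj⟩ : ∃ j, 2 ≤ (α.filter (j ∈ ·)).card := by
    by_contra! h
    refine hredundant.not_ge ?_
    calc ∑ A ∈ α, A.card = ∑ i, (α.filter (i ∈ ·)).card := by
          simp_rw [Finset.card_eq_sum_ones]
          exact Finset.sum_comm' (by simp)
      _ ≤ ∑ _i : ι, 1 := Finset.sum_le_sum fun i _ => Nat.le_of_lt_succ (h i)
      _ = Fintype.card ι := by simp
  intro ε hε
  refine ⟨min ε 1, lt_min hε one_pos, fun v hv => ?_⟩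
  rw [Finset.prod_prod_eq_prod_pow_card_filter_mem]
  refine (Finset.prod_pow_le_mul_prod (min_le_right ε 1) (fun i => norm_nonneg (v i)) hv
    hm hj).trans ?_
  exact mul_le_mul_of_nonneg_right (min_le_left ε 1)
    (Finset.prod_nonneg fun i _ => norm_nonneg (v i))
end
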